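/- arXiv:2507.11234 — 3 statements merged into one kernel-verified Lean document; each statement's English description precedes it below -/
import Mathlib

section
/- Let u : ℕ → ℤ satisfy an order-d integer linear recurrence u_{n+d} = a_{d-1} u_{n+d-1} + … + a_0 u_n, let p be a prime with p > d+1 and p ∤ a_0, let A be the companion matrix of the recurrence, and let M be a positive integer with A^M ≡ I (mod p). Fix ℓ ∈ {0, …, M−1} and suppose the subsequence n ↦ u_{Mn+ℓ} is not identically zero. For k ∈ ℕ set β_k = Σ_{j=0}^{k} (−1)^{k−j} C(k,j) u_{Mj+ℓ} ∈ ℤ. Then |β_k|_p → 0, so F_ℓ(x) = Σ_{k=0}^{∞} β_k binom(x,k) defines a continuous function ℤ_p → ℤ_p with F_ℓ(n) = u_{Mn+ℓ} for all n ∈ ℕ, and the zero set {x ∈ ℤ_p : F_ℓ(x) = 0} is finite with at most d − 1 elements. -/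
open Filter Finset

/-- The companion matrix of the linear recurrence with coefficients `a_0, …, a_{d-1}`
(where `u_{n+d} = a_{d-1} u_{n+d-1} + … + a_0 u_n`): its first row is
`(a_{d-1}, …, a_1, a_0)`, its subdiagonal entries are `1` and all other entries are `0`. -/
def companionMatrix {d : ℕ} (a : Fin d → ℤ) : Matrix (Fin d) (Fin d) ℤ :=
  Matrix.of fun i j =>
    if (i : ℕ) = 0 then a j.rev else if (j : ℕ) + 1 = (i : ℕ) then 1 else 0


lemma aux_summable {p : ℕ} [hp : Fact p.Prime] {b : ℕ → ℤ_[p]} (hb : Tendsto b atTop (nhds 0))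
    (z : ℕ → ℤ_[p]) : Summable fun k => b k * z k := by
  apply NonarchimedeanAddGroup.summable_of_tendsto_cofinite_zero
  rw [Nat.cofinite_eq_atTop]
  rw [tendsto_zero_iff_norm_tendsto_zero] at hb ⊢
  refine squeeze_zero (fun _ => norm_nonneg _) (fun k => ?_) hb
  rw [norm_mul]
  exact mul_le_of_le_one_right (norm_nonneg _) (PadicInt.norm_le_one _)

open Polynomial in
lemma aux_strassmann {p : ℕ} [hp : Fact p.Prime] {b : ℕ → ℤ_[p]} (hb : Tendsto b atTop (nhds 0))
    (P : ℕ → ℤ_[p][X]) (hPm : ∀ k, (P k).Monic) (hPd : ∀ k, (P k).natDegree = k)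
    (N E : ℕ) (hN : ¬ (p : ℤ_[p]) ^ E ∣ b N) (hgt : ∀ k, N < k → (p : ℤ_[p]) ^ E ∣ b k)
    (s : Finset ℤ_[p]) (hs : ∀ x ∈ s, ∑' k, b k * (P k).eval x = 0) : s.card ≤ N := by
  by_contra hcon
  push Not at hcon
  obtain ⟨t, hts, htc⟩ := Finset.exists_subset_card_eq (Nat.succ_le_of_lt hcon)
  set Q : ℤ_[p][X] := ∏ x ∈ t, (X - C x) with hQ
  have hQm : Q.Monic := monic_prod_of_monic _ _ (fun x _ => monic_X_sub_C x)
  have hQd : Q.natDegree = N + 1 := by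
    rw [hQ, natDegree_prod_of_monic _ _ (fun x _ => monic_X_sub_C x)]; simp [htc]
  have hQ1 : Q ≠ 1 := by intro h; rw [h] at hQd; simp at hQd
  set r : ℕ → ℤ_[p][X] := fun k => P k %ₘ Q with hr
  have hrd : ∀ k, (r k).natDegree < N + 1 := fun k => by
    rw [← hQd]; exact natDegree_modByMonic_lt _ hQm hQ1
  have hre : ∀ k, ∀ x ∈ t, (r k).eval x = (P k).eval x := fun k x hx => by
    have : Q.eval x = 0 := by
      rw [hQ, eval_prod]; exact Finset.prod_eq_zero hx (by simp)
    have h2 := congrArg (eval x) (modByMonic_add_div (P k) Q)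
    simpa [this] using h2
  set R : ℤ_[p][X] := ∑ i ∈ range (N + 1), C (∑' k, b k * (r k).coeff i) * X ^ i with hR
  have hRd : R.natDegree < #t := by
    rw [htc, Nat.lt_succ_iff, hR]
    apply natDegree_sum_le_of_forall_le
    intro i hi
    exact (natDegree_C_mul_X_pow_le _ _).trans (by simpa [Nat.lt_succ_iff] using hi)
  have hR0 : R = 0 := by
    apply eq_zero_of_natDegree_lt_card_of_eval_eq_zero' R t _ hRd
    intro x hx
    rw [← hs x (hts hx), hR, eval_finsetSum]
    simp only [eval_mul, eval_C, eval_pow, eval_X]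
    rw [Finset.sum_congr rfl fun i _ => ((aux_summable hb fun k => (r k).coeff i).tsum_mul_right (x ^ i)).symm]
    rw [← Summable.tsum_finsetSum]
    · congr 1; ext1 k
      rw [← hre k x hx, eval_eq_sum_range' (hrd k), Finset.mul_sum]
      exact Finset.sum_congr rfl fun i _ => mul_assoc _ _ _
    · intro i _
      simp_rw [mul_assoc]
      exact aux_summable hb _
  have hc : ∑' k, b k * (r k).coeff N = 0 := by
    have := congrArg (fun q => q.coeff N) hR0
    simpa [hR, finsetSum_coeff, coeff_C_mul, coeff_X_pow] using this
  have hsm : ∀ k, k ≤ N → r k = P k := fun k hk => by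
    rw [hr]
    apply (modByMonic_eq_self_iff hQm).2
    apply degree_lt_degree
    rw [hQd, hPd]; lia
  rw [(aux_summable hb _).tsum_eq_add_tsum_ite N] at hc
  have h1 : (r N).coeff N = 1 := by
    rw [hsm N le_rfl]; have := hPm N; rw [Monic, leadingCoeff, hPd] at this; exact this
  rw [h1, mul_one] at hc
  apply hN
  rw [eq_neg_of_add_eq_zero_left hc, dvd_neg, ← Ideal.mem_span_singleton,
    ← PadicInt.norm_le_pow_iff_mem_span_pow]
  apply IsUltrametricDist.norm_tsum_le_of_forall_le_of_nonneg (by positivity)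
  intro k
  rw [PadicInt.norm_le_pow_iff_mem_span_pow, Ideal.mem_span_singleton]
  split_ifs with h
  · exact dvd_zero _
  · rcases lt_or_gt_of_ne h with h | h
    · rw [hsm k h.le, coeff_eq_zero_of_natDegree_lt (by rw [hPd]; exact h), mul_zero]
      exact dvd_zero _
    · exact (hgt k h).mul_right _

lemma aux_fact (p : ℕ) [hp : Fact p.Prime] (k m : ℕ) (h : padicValNat p k.factorial + m ≤ k) :
    (k.factorial : ℤ_[p]) * (p : ℤ_[p]) ^ m ∣ (p : ℤ_[p]) ^ k := by
  obtain ⟨n, hn⟩ := Nat.exists_eq_add_of_le h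
  have h0 : (k.factorial : ℤ_[p]) ∣ (p : ℤ_[p]) ^ (padicValNat p k.factorial) := by
    obtain ⟨w, hw⟩ := @pow_padicValNat_dvd p k.factorial
    have hpw : ¬ p ∣ w := by
      rintro ⟨c, rfl⟩
      apply @pow_succ_padicValNat_not_dvd p k.factorial _ (Nat.factorial_ne_zero _)
      exact ⟨c, by rw [pow_succ, mul_assoc]; exact hw⟩
    have hu : IsUnit (w : ℤ_[p]) := by
      rw [PadicInt.isUnit_iff]
      refine le_antisymm (PadicInt.norm_le_one _) (not_lt.1 fun hlt => hpw ?_)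
      have := (PadicInt.norm_int_lt_one_iff_dvd (p := p) (w : ℤ)).1 (by simpa using hlt)
      exact_mod_cast this
    have hw' : (k.factorial : ℤ_[p]) = (p : ℤ_[p]) ^ (padicValNat p k.factorial) * w := by
      exact_mod_cast congrArg (Nat.cast (R := ℤ_[p])) hw
    rw [hw']
    exact (hu.mul_right_dvd).2 dvd_rfl
  calc _ ∣ (p : ℤ_[p]) ^ (padicValNat p k.factorial) * (p : ℤ_[p]) ^ m := mul_dvd_mul_right h0 _
    _ ∣ (p : ℤ_[p]) ^ k := by rw [← pow_add]; exact pow_dvd_pow _ h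

lemma aux_val (p d k : ℕ) [hp : Fact p.Prime] (hpd : d + 1 < p) (hk : d ≤ k) :
    padicValNat p k.factorial + d ≤ k := by
  rcases lt_or_ge k p with h | h
  · rw [padicValNat.eq_zero_of_not_dvd]
    · lia
    · rw [hp.out.dvd_factorial]; lia
  · have h1 := sub_one_mul_padicValNat_factorial_lt_of_ne_zero (p := p) (n := k) (by lia)
    obtain ⟨q, rfl⟩ : ∃ q, p = q + 1 := ⟨p - 1, by lia⟩
    simp only [Nat.add_sub_cancel] at h1
    set v := padicValNat (q + 1) k.factorial
    by_contra hcon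
    nlinarith

lemma aux_val2 (p k : ℕ) [hp : Fact p.Prime] (hp3 : 2 < p) :
    padicValNat p k.factorial + k / 2 ≤ k := by
  rcases Nat.eq_zero_or_pos k with rfl | h
  · simp
  · have h1 := sub_one_mul_padicValNat_factorial_lt_of_ne_zero (p := p) (n := k) (by lia)
    have : 2 * padicValNat p k.factorial ≤ (p - 1) * padicValNat p k.factorial :=
      Nat.mul_le_mul_right _ (by lia)
    lia

lemma aux_state {d : ℕ} (hd : 0 < d) (a : Fin d → ℤ) (u : ℕ → ℤ)
    (hrec : ∀ n : ℕ, u (n + d) = ∑ i : Fin d, a i * u (n + i)) (n m : ℕ) :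
    (companionMatrix a ^ m).mulVec (fun i : Fin d => u (n + i.rev)) =
      fun i : Fin d => u (n + m + i.rev) := by
  have step : ∀ n, (companionMatrix a).mulVec (fun i : Fin d => u (n + i.rev)) =
      fun i : Fin d => u (n + 1 + i.rev) := by
    intro n
    ext i
    simp only [Matrix.mulVec, dotProduct, companionMatrix, Matrix.of_apply]
    by_cases hi : (i : ℕ) = 0
    · simp only [hi, if_true]
      rw [show n + 1 + (i.rev : ℕ) = n + d by simp [Fin.val_rev]; lia, hrec]
      exact Fintype.sum_equiv Fin.revPerm _ _ (fun j => by simp)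
    · simp only [hi, if_false]
      rw [Finset.sum_eq_single (⟨i - 1, by lia⟩ : Fin d)]
      · simp only [Fin.val_rev]
        rw [if_pos (by lia), one_mul]
        congr 1
        lia
      · intro j _ hj
        rw [if_neg, zero_mul]
        intro h
        apply hj
        ext
        simp
        lia
      · simp
  induction m with
  | zero => simp
  | succ m ih => rw [pow_succ', ← Matrix.mulVec_mulVec, ih, step]; rfl

/-- algebraic data: `γ`. -/
lemma aux_gamma (p d : ℕ) (hd : 0 < d) (a : Fin d → ℤ) (u : ℕ → ℤ)
    (hrec : ∀ n : ℕ, u (n + d) = ∑ i : Fin d, a i * u (n + i))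
    (M : ℕ) (hAM : ∀ i j, (p : ℤ) ∣ ((companionMatrix a) ^ M - 1) i j) (ℓ : ℕ)
    (β : ℕ → ℤ)
    (hβ : ∀ k : ℕ, β k = ∑ j ∈ Finset.range (k + 1),
      (-1 : ℤ) ^ (k - j) * (k.choose j : ℤ) * u (M * j + ℓ)) :
    ∃ γ : ℕ → ℤ, (∀ k, β k = (p : ℤ) ^ k * γ k) ∧
      (∀ n, u (M * n + ℓ) = ∑ k ∈ range (n + 1), (n.choose k : ℤ) * β k) ∧
      (∀ k, ∃ c : ℕ → ℤ, γ k = ∑ i ∈ range d, c i * γ i) := by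
  choose C hC using hAM
  set A := companionMatrix a
  set U : Fin d → ℤ := fun i => u (ℓ + i.rev) with hU
  let l : Fin d := ⟨d - 1, by lia⟩
  have hl : (l.rev : ℕ) = 0 := by simp [Fin.val_rev, l]; lia
  let φ : Matrix (Fin d) (Fin d) ℤ →+ ℤ :=
    { toFun := fun B => B.mulVec U l
      map_zero' := by simp
      map_add' := fun B B' => by simp [Matrix.add_mulVec] }
  have hφs : ∀ (c : ℤ) B, φ (c • B) = c * φ B := fun c B => by rw [map_zsmul, smul_eq_mul]
  have hφu : ∀ n, φ ((A ^ M) ^ n) = u (M * n + ℓ) := fun n => by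
    change ((A ^ M) ^ n).mulVec U l = _
    rw [← pow_mul, aux_state hd a u hrec]
    simp only [hl, add_zero]
    rw [add_comm]
  let C' : Matrix (Fin d) (Fin d) ℤ := Matrix.of C
  have hAC : A ^ M - 1 = (p : ℤ) • C' := by
    ext i j; simp [C', hC i j]
  have hβφ : ∀ k, β k = φ ((A ^ M - 1) ^ k) := fun k => by
    rw [hβ, sub_eq_add_neg, (Commute.neg_one_right (A ^ M)).add_pow, map_sum]
    refine Finset.sum_congr rfl fun j _ => ?_
    rw [← hφu, ← hφs]
    congr 1
    rw [zsmul_eq_mul]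
    push_cast
    exact ((((Commute.neg_one_left _).pow_left _).mul_left (Nat.cast_commute _ _)).eq).trans
      (mul_assoc _ _ _).symm
  refine ⟨fun k => φ (C' ^ k), fun k => ?_, fun n => ?_, fun k => ?_⟩
  · rw [hβφ, hAC, smul_pow, hφs]
  · have : A ^ M = (A ^ M - 1) + 1 := by abel
    rw [← hφu, this, (Commute.one_right _).add_pow, map_sum]
    refine Finset.sum_congr rfl fun k _ => ?_
    rw [hβφ, ← hφs]
    congr 1
    simp only [one_pow, mul_one, zsmul_eq_mul, Int.cast_natCast]
    exact (Nat.cast_comm _ _).symm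
  · refine ⟨fun i => (Polynomial.X ^ k %ₘ C'.charpoly).coeff i, ?_⟩
    have hdeg : (Polynomial.X ^ k %ₘ C'.charpoly).natDegree < d := by
      have h1 : C'.charpoly.natDegree = d := by simp [Matrix.charpoly_natDegree_eq_dim]
      conv_rhs => rw [← h1]
      apply Polynomial.natDegree_modByMonic_lt _ (Matrix.charpoly_monic _)
      intro h
      rw [h] at h1; simp at h1; lia
    simp only
    rw [Matrix.pow_eq_aeval_mod_charpoly, Polynomial.aeval_eq_sum_range' hdeg, map_sum]
    exact Finset.sum_congr rfl fun i _ => hφs _ _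

lemma aux_min (p d : ℕ) [hp : Fact p.Prime] (γ : ℕ → ℤ) (h : ∃ j < d, γ j ≠ 0) :
    ∃ e, (∀ i < d, (p : ℤ) ^ e ∣ γ i) ∧ ∃ j < d, ¬ (p : ℤ) ^ (e + 1) ∣ γ j := by
  classical
  have hex : ∃ e : ℕ, ∃ j < d, ¬ (p : ℤ) ^ (e + 1) ∣ γ j := by
    obtain ⟨j, hj, hne⟩ := h
    have hf : FiniteMultiplicity (p : ℤ) (γ j) :=
      Int.finiteMultiplicity_iff.2 ⟨by simpa using hp.out.ne_one, hne⟩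
    obtain ⟨n, hn⟩ := hf
    exact ⟨n, j, hj, hn⟩
  refine ⟨Nat.find hex, ?_, Nat.find_spec hex⟩
  intro i hi
  rcases hE : Nat.find hex with _ | e
  · simp
  · have := Nat.find_min hex (m := e) (by lia)
    push Not at this
    exact this i hi

/-- Let `u` satisfy an order-`d` integer linear recurrence, `p > d+1` a prime
not dividing `a_0`, `A` the companion matrix and `M > 0` with `A^M ≡ I (mod p)`.  Fix `ℓ < M`
with `n ↦ u (M*n+ℓ)` not identically zero and let `β_k` be the `k`-th forward difference at `0`
of this subsequence.  Then `|β_k|_p → 0`, so `F_ℓ(x) = ∑_k β_k binom(x,k)` defines a continuous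
function `ℤ_p → ℤ_p` with `F_ℓ(n) = u (M*n+ℓ)` for all `n ∈ ℕ`, and the zero set of `F_ℓ`
in `ℤ_p` is finite with at most `d − 1` elements. -/
theorem lrs_interpolation_finite_zeros (p d : ℕ) [hp : Fact p.Prime] (hd : 0 < d)
    (hpd : d + 1 < p) (a : Fin d → ℤ) (u : ℕ → ℤ)
    (hrec : ∀ n : ℕ, u (n + d) = ∑ i : Fin d, a i * u (n + i))
    (ha0 : ¬ ((p : ℤ) ∣ a ⟨0, hd⟩))
    (M : ℕ) (hM : 0 < M)
    (hAM : ∀ i j, (p : ℤ) ∣ ((companionMatrix a) ^ M - 1) i j)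
    (ℓ : ℕ) (hℓ : ℓ < M) (hne : ∃ n : ℕ, u (M * n + ℓ) ≠ 0)
    (β : ℕ → ℤ)
    (hβ : ∀ k : ℕ, β k = ∑ j ∈ Finset.range (k + 1),
      (-1 : ℤ) ^ (k - j) * (k.choose j : ℤ) * u (M * j + ℓ)) :
    Tendsto (fun k => ‖((β k : ℤ) : ℤ_[p])‖) atTop (nhds 0) ∧
    ∃ F : ℤ_[p] → ℤ_[p], Continuous F ∧
      (∀ x : ℤ_[p], F x = ∑' k : ℕ, ((β k : ℤ) : ℤ_[p]) * Ring.choose x k) ∧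
      (∀ n : ℕ, F (n : ℤ_[p]) = ((u (M * n + ℓ) : ℤ) : ℤ_[p])) ∧
      {x : ℤ_[p] | F x = 0}.Finite ∧ {x : ℤ_[p] | F x = 0}.ncard ≤ d - 1 := by
  obtain ⟨γ, hγ, hu, hγr⟩ := aux_gamma p d hd a u hrec M hAM ℓ β hβ
  have hβt : Tendsto (fun k => ((β k : ℤ) : ℤ_[p])) atTop (nhds 0) := by
    rw [tendsto_zero_iff_norm_tendsto_zero]
    refine squeeze_zero (fun _ => norm_nonneg _) (fun k => ?_)
      (tendsto_pow_atTop_nhds_zero_of_lt_one (norm_nonneg _) (PadicInt.mem_nonunits.1 (PadicInt.p_nonunit (p := p))))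
    rw [hγ]
    push_cast
    rw [norm_mul, norm_pow]
    exact mul_le_of_le_one_right (by positivity) (PadicInt.norm_le_one _)
  have hFx : ∀ x : ℤ_[p], PadicInt.mahlerSeries (fun k => ((β k : ℤ) : ℤ_[p])) x =
      ∑' k : ℕ, ((β k : ℤ) : ℤ_[p]) * Ring.choose x k := fun x => by
    rw [PadicInt.mahlerSeries_apply hβt]
    simp only [mahler_apply, smul_eq_mul, mul_comm]
  refine ⟨tendsto_zero_iff_norm_tendsto_zero.1 hβt,
    PadicInt.mahlerSeries (fun k => ((β k : ℤ) : ℤ_[p])), ContinuousMap.continuous _, hFx, fun n => ?_, ?_⟩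
  · rw [PadicInt.mahlerSeries_apply_nat hβt le_rfl, hu]
    push_cast
    simp
  -- the coefficients in the falling factorial basis
  have hex : ∃ j < d, γ j ≠ 0 := by
    by_contra hcon
    push Not at hcon
    obtain ⟨n, hn⟩ := hne
    apply hn
    rw [hu]
    refine Finset.sum_eq_zero fun k _ => ?_
    obtain ⟨c, hc⟩ := hγr k
    rw [hγ, hc, Finset.sum_eq_zero fun i hi => by rw [hcon i (by simpa using hi), mul_zero]]
    simp
  obtain ⟨e, he, j, hjd, hj⟩ := aux_min p d γ hex
  have hall : ∀ k, (p : ℤ) ^ e ∣ γ k := fun k => by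
    obtain ⟨c, hc⟩ := hγr k
    rw [hc]
    exact Finset.dvd_sum fun i hi => (he i (by simpa using hi)).mul_left _
  have hall' : ∀ k, (p : ℤ_[p]) ^ e ∣ (γ k : ℤ_[p]) := fun k =>
    (PadicInt.pow_p_dvd_int_iff _ _).2 (hall k)
  have hp0 : (p : ℤ_[p]) ≠ 0 := by exact_mod_cast hp.out.ne_zero
  have hf0 : ∀ k : ℕ, (k.factorial : ℤ_[p]) ≠ 0 := fun k => by
    exact_mod_cast k.factorial_ne_zero
  choose c hc using fun k => (dvd_of_mul_right_dvd (aux_fact p k _ (aux_val2 p k (by lia))))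
  have hcm : ∀ k m, padicValNat p k.factorial + m ≤ k → (p : ℤ_[p]) ^ m ∣ c k := by
    intro k m h
    have := aux_fact p k m h
    rw [hc k] at this
    exact (mul_dvd_mul_iff_left (hf0 k)).1 this
  set b : ℕ → ℤ_[p] := fun k => c k * γ k with hb
  have hbβ : ∀ k, (β k : ℤ_[p]) = k.factorial * b k := fun k => by
    rw [hγ]
    push_cast
    rw [hc, hb, mul_assoc]
  have hbt : Tendsto b atTop (nhds 0) := by
    rw [tendsto_zero_iff_norm_tendsto_zero]
    refine squeeze_zero (fun _ => norm_nonneg _) (fun k => ?_)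
      ((tendsto_pow_atTop_nhds_zero_of_lt_one (norm_nonneg _)
        (PadicInt.mem_nonunits.1 (PadicInt.p_nonunit (p := p)))).comp (Nat.tendsto_div_const_atTop (two_ne_zero)))
    obtain ⟨w, hw⟩ := (hcm k _ (aux_val2 p k (by lia))).mul_right (γ k : ℤ_[p])
    simp only [hb, Function.comp]
    rw [hw, norm_mul, norm_pow]
    exact mul_le_of_le_one_right (by positivity) (PadicInt.norm_le_one _)
  have hFb : ∀ x : ℤ_[p], PadicInt.mahlerSeries (fun k => ((β k : ℤ) : ℤ_[p])) x =
      ∑' k : ℕ, b k * (descPochhammer ℤ_[p] k).eval x := fun x => by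
    rw [hFx]
    congr 1
    ext1 k
    have h1 := Ring.descPochhammer_eq_factorial_smul_choose x k
    rw [← descPochhammer_map (Int.castRingHom ℤ_[p]) k, Polynomial.eval_map,
      ← Polynomial.eval₂_smulOneHom_eq_smeval] at *
    rw [show Int.castRingHom ℤ_[p] = RingHom.smulOneHom from Subsingleton.elim _ _, h1, hbβ,
      nsmul_eq_mul]
    ring
  have hbig : ∀ k, d ≤ k → (p : ℤ_[p]) ^ (e + d) ∣ b k := fun k hk => by
    rw [add_comm, pow_add]
    exact mul_dvd_mul (hcm k d (aux_val p d k hpd hk)) (hall' k)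
  have hbj : ¬ (p : ℤ_[p]) ^ (e + d) ∣ b j := by
    intro h
    have h1 : (p : ℤ_[p]) ^ (e + d) ∣ (p : ℤ_[p]) ^ j * γ j := by
      rw [hc j, mul_assoc]
      exact h.mul_left _
    rw [show e + d = j + (e + (d - j)) by lia, pow_add, mul_dvd_mul_iff_left (pow_ne_zero _ hp0)]
      at h1
    apply hj
    rw [← PadicInt.pow_p_dvd_int_iff]
    exact (pow_dvd_pow _ (by lia)).trans h1
  obtain ⟨N, hNd, hN, hgt⟩ : ∃ N < d, ¬ (p : ℤ_[p]) ^ (e + d) ∣ b N ∧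
      ∀ k, N < k → (p : ℤ_[p]) ^ (e + d) ∣ b k := by
    classical
    set S := (range d).filter fun k => ¬ (p : ℤ_[p]) ^ (e + d) ∣ b k with hS
    have hSne : S.Nonempty := ⟨j, by simp [hS, hjd, hbj]⟩
    have hm := S.max'_mem hSne
    have hm := mem_filter.1 hm
    rw [mem_range] at hm
    refine ⟨S.max' hSne, hm.1, hm.2, fun k hk => ?_⟩
    by_contra hcon
    have hkd : k < d := by
      by_contra h
      exact hcon (hbig k (by lia))
    have : k ≤ S.max' hSne := S.le_max' k (by simp [hS, hkd, hcon])
    lia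
  have key : ∀ s : Finset ℤ_[p],
      (s : Set ℤ_[p]) ⊆ {x | PadicInt.mahlerSeries (fun k => ((β k : ℤ) : ℤ_[p])) x = 0} → s.card ≤ N := by
    intro s hs
    refine aux_strassmann hbt (fun k => descPochhammer ℤ_[p] k)
      (fun k => monic_descPochhammer _ k) (fun k => descPochhammer_natDegree _ k) N (e + d) hN hgt s
      fun x hx => ?_
    rw [← hFb]
    exact hs hx
  have hfin : {x : ℤ_[p] | PadicInt.mahlerSeries (fun k => ((β k : ℤ) : ℤ_[p])) x = 0}.Finite := by
    by_contra hinf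
    obtain ⟨t, ht, htc⟩ := Set.Infinite.exists_subset_card_eq hinf (N + 1)
    have := key t ht
    lia
  refine ⟨hfin, ?_⟩
  rw [Set.ncard_eq_toFinset_card _ hfin]
  have := key hfin.toFinset (by simp)
  lia
end

section
/- Let u : ℕ → ℤ satisfy an order-d integer linear recurrence u_{n+d} = a_{d-1} u_{n+d-1} + … + a_0 u_n, let p be a prime with p > d+1 and p ∤ a_0, let A be the companion matrix of the recurrence, and let M be a positive integer with A^M ≡ I (mod p). Fix ℓ ∈ {0, …, M−1} and suppose the subsequence n ↦ u_{Mn+ℓ} is not identically zero. For k ∈ ℕ set β_k = Σ_{j=0}^{k} (−1)^{k−j} C(k,j) u_{Mj+ℓ} ∈ ℤ. Then there exists a sequence b : ℕ → ℤ_p with |b_j|_p → 0 such that Σ_{j} b_j x^j = Σ_{k} β_k binom(x,k) for all x ∈ ℤ_p. Moreover, min_j v_p(b_j) = min_{0 ≤ k ≤ d−1} v_p(β_k), and the largest index j with v_p(b_j) minimal equals the largest k ∈ {0, …, d−1} with v_p(β_k) = min_{0 ≤ i ≤ d−1} v_p(β_i); in particular this index is at most d − 1. -/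
open Filter Finset

/-- The additive `p`-adic valuation on `ℚ_p`, with values in `WithTop ℤ` (`v_p 0 = ∞`). -/
noncomputable def vP (p : ℕ) [Fact p.Prime] (x : ℚ_[p]) : WithTop ℤ :=
  Padic.addValuation x

open Polynomial in
lemma lrs_alg (p d : ℕ) (hd : 0 < d) (a : Fin d → ℤ) (u : ℕ → ℤ)
    (hrec : ∀ n : ℕ, u (n + d) = ∑ i : Fin d, a i * u (n + i))
    (M : ℕ) (hAM : ∀ i j, (p : ℤ) ∣ ((companionMatrix a) ^ M - 1) i j)
    (ℓ : ℕ) (β : ℕ → ℤ)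
    (hβ : ∀ k : ℕ, β k = ∑ j ∈ Finset.range (k + 1),
      (-1 : ℤ) ^ (k - j) * (k.choose j : ℤ) * u (M * j + ℓ)) :
    (∀ n, u (M * n + ℓ) = ∑ k ∈ Finset.range (n + 1), (n.choose k : ℤ) * β k) ∧
    (∀ k, d ≤ k → ∃ c : ℕ → ℤ, β k = ∑ i ∈ Finset.range d, c i * (p : ℤ) ^ (k - i) * β i) := by
  set A := companionMatrix a with hA
  let w : ℕ → Fin d → ℤ := fun n i => u (n + (i.rev : ℕ))
  have hstep : ∀ n, A.mulVec (w n) = w (n + 1) := by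
    intro n
    ext i
    simp only [Matrix.mulVec, dotProduct, hA, companionMatrix, Matrix.of_apply, w]
    by_cases hi : (i : ℕ) = 0
    · simp only [hi, if_true]
      have h1 : n + 1 + (i.rev : ℕ) = n + d := by
        rw [Fin.val_rev]; omega
      rw [h1, hrec]
      exact Fintype.sum_equiv Fin.revPerm _ _ (fun x => by simp)
    · simp only [hi, if_false]
      have hlt : (i : ℕ) - 1 < d := by omega
      rw [Finset.sum_eq_single (⟨(i : ℕ) - 1, hlt⟩ : Fin d)]
      · have : (i : ℕ) - 1 + 1 = i := by omega
        simp only [this, if_true, one_mul, Fin.val_rev]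
        congr 1; omega
      · intro b _ hb
        rw [if_neg, zero_mul]
        intro h; apply hb; ext; simp; omega
      · simp
  have hpow : ∀ m n, (A ^ m).mulVec (w n) = w (n + m) := by
    intro m
    induction m with
    | zero => intro n; simp
    | succ m ih => intro n; rw [pow_succ, ← Matrix.mulVec_mulVec, hstep, ih]; congr 1; ring
  let last : Fin d := ⟨d - 1, by omega⟩
  have hlast : ((last.rev : Fin d) : ℕ) = 0 := by simp [last, Fin.val_rev]; omega
  let φ : Matrix (Fin d) (Fin d) ℤ →ₗ[ℤ] ℤ :=
    { toFun := fun X => (X.mulVec (w ℓ)) last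
      map_add' := fun X Y => by simp [Matrix.add_mulVec]
      map_smul' := fun c X => by rw [Matrix.smul_mulVec]; rfl }
  have hφu : ∀ j, φ ((A ^ M) ^ j) = u (M * j + ℓ) := by
    intro j
    change ((A ^ M) ^ j).mulVec (w ℓ) last = _
    rw [← pow_mul, hpow]
    simp only [w, hlast]
    congr 1; ring
  have hφβ : ∀ k, β k = φ ((A ^ M - 1) ^ k) := by
    intro k
    have hc : Commute (A ^ M) (-1 : Matrix (Fin d) (Fin d) ℤ) := (Commute.one_right _).neg_right
    rw [hβ, sub_eq_add_neg, hc.add_pow, map_sum]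
    refine Finset.sum_congr rfl fun j _ => ?_
    have : (A ^ M) ^ j * (-1) ^ (k - j) * ((k.choose j : ℕ) : Matrix (Fin d) (Fin d) ℤ)
        = ((-1 : ℤ) ^ (k - j) * (k.choose j : ℤ)) • (A ^ M) ^ j := by
      rw [zsmul_eq_mul, mul_assoc]
      push_cast
      exact (Commute.mul_right ((Commute.neg_one_right _).pow_right _) (Nat.cast_commute _ _).symm).eq
    rw [this, map_smul, hφu, smul_eq_mul]
  refine ⟨?_, ?_⟩
  · intro n
    rw [← hφu]
    have : A ^ M = (A ^ M - 1) + 1 := by simp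
    rw [this, (Commute.one_right _).add_pow, map_sum]
    refine Finset.sum_congr rfl fun j _ => ?_
    rw [one_pow, mul_one, (Nat.cast_commute _ _).symm.eq, ← nsmul_eq_mul, map_nsmul, hφβ, nsmul_eq_mul]
  · intro k hk
    choose B hB using hAM
    have hBm : A ^ M - 1 = (p : ℤ) • Matrix.of B := by
      ext i j; simp [hB]
    have hφγ : ∀ k, β k = (p : ℤ) ^ k * φ ((Matrix.of B) ^ k) := by
      intro k; rw [hφβ, hBm, _root_.smul_pow, map_smul, smul_eq_mul]
    set N : Matrix (Fin d) (Fin d) ℤ := Matrix.of B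
    have hdeg : (X ^ k %ₘ N.charpoly).natDegree < d := by
      have := natDegree_modByMonic_lt (X ^ k : ℤ[X]) (Matrix.charpoly_monic N) (by
        intro h
        have := congrArg natDegree h
        rw [Matrix.charpoly_natDegree_eq_dim] at this
        simp at this; omega)
      rwa [Matrix.charpoly_natDegree_eq_dim, Fintype.card_fin] at this
    refine ⟨fun i => (X ^ k %ₘ N.charpoly).coeff i, ?_⟩
    rw [hφγ, Matrix.pow_eq_aeval_mod_charpoly, aeval_eq_sum_range' hdeg, map_sum, Finset.mul_sum]
    refine Finset.sum_congr rfl fun i hi => ?_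
    have hi' : i < d := Finset.mem_range.1 hi
    rw [map_smul, smul_eq_mul, hφγ i]
    have : (p : ℤ) ^ k = (p : ℤ) ^ (k - i) * (p : ℤ) ^ i := by rw [← pow_add]; congr 1; omega
    rw [this]; ring

open Polynomial in
lemma lrs_series (p : ℕ) [hp : Fact p.Prime] (δ : ℕ → ℤ_[p]) (K : ℕ)
    (h0 : Tendsto δ atTop (nhds 0)) (hK0 : δ K ≠ 0) (hle : ∀ k, ‖δ k‖ ≤ ‖δ K‖)
    (hlt : ∀ k, K < k → ‖δ k‖ < ‖δ K‖) :
    ∃ b : ℕ → ℤ_[p], Tendsto (fun j => ‖b j‖) atTop (nhds 0) ∧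
      (∀ x : ℤ_[p], ∑' j : ℕ, b j * x ^ j = ∑' k : ℕ, δ k * (k.factorial * Ring.choose x k)) ∧
      (∀ j, ‖b j‖ ≤ ‖δ K‖) ∧ (∀ j, K < j → ‖b j‖ < ‖δ K‖) ∧ ‖b K‖ = ‖δ K‖ := by
  obtain ⟨r, hr, hr0, hrlt⟩ : ∃ r : ℝ, r < ‖δ K‖ ∧ 0 ≤ r ∧ ∀ k, K < k → ‖δ k‖ ≤ r := by
    have hn := PadicInt.norm_eq_zpow_neg_valuation hK0
    have hp1 : (1 : ℝ) < p := by exact_mod_cast hp.out.one_lt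
    refine ⟨(p : ℝ) ^ (-((δ K).valuation : ℤ) - 1), ?_, by positivity, fun k hk => ?_⟩
    · rw [hn]; exact zpow_lt_zpow_right₀ hp1 (by omega)
    · rw [← PadicInt.norm_lt_pow_iff_norm_le_pow_sub_one, ← hn]; exact hlt k hk
  let s : ℕ → ℕ → ℤ_[p] := fun k j => (((descPochhammer ℤ k).coeff j : ℤ) : ℤ_[p])
  have hs0 : ∀ k j, k < j → s k j = 0 := by
    intro k j h
    simp only [s]
    rw [coeff_eq_zero_of_natDegree_lt (by rwa [descPochhammer_natDegree]), Int.cast_zero]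
  have hs1 : ∀ k, s k k = 1 := by
    intro k
    have := (monic_descPochhammer ℤ k).coeff_natDegree
    rw [descPochhammer_natDegree] at this
    simp [s, this]
  have hsx : ∀ k (x : ℤ_[p]), ∑ j ∈ Finset.range (k + 1), s k j * x ^ j
      = k.factorial * Ring.choose x k := by
    intro k x
    rw [← nsmul_eq_mul, ← Ring.descPochhammer_eq_factorial_smul_choose, smeval_eq_sum,
      sum_over_range' _ _ (k + 1) (by rw [descPochhammer_natDegree]; omega)]
    · simp [s, Polynomial.smul_pow]
    · simp [Polynomial.smul_pow]
  have hterm : ∀ k j (x : ℤ_[p]), ‖δ k * s k j * x ^ j‖ ≤ ‖δ k‖ := by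
    intro k j x
    rw [mul_assoc, norm_mul]
    exact mul_le_of_le_one_right (norm_nonneg _) (PadicInt.norm_le_one _)
  have hterm' : ∀ k j, ‖δ k * s k j‖ ≤ ‖δ k‖ := by
    intro k j; simpa using hterm k j 1
  have hsum : ∀ x : ℤ_[p], Summable (fun q : ℕ × ℕ => δ q.1 * s q.1 q.2 * x ^ q.2) := by
    intro x
    apply NonarchimedeanAddGroup.summable_of_tendsto_cofinite_zero
    rw [Metric.tendsto_nhds]
    intro ε hε
    rw [Metric.tendsto_atTop] at h0
    obtain ⟨N, hN⟩ := h0 ε hε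
    rw [Filter.eventually_cofinite]
    refine Set.Finite.subset ((Finset.range N ×ˢ Finset.range N).finite_toSet) ?_
    rintro ⟨k, j⟩ hq
    simp only [Set.mem_ofPred_eq, dist_zero_right, not_lt] at hq
    have hkN : k < N := by
      by_contra h
      have := hN k (by omega)
      rw [dist_zero_right] at this
      exact absurd (hq.trans (hterm k j x)) (not_le.2 this)
    have hj : j ≤ k := by
      by_contra h
      rw [hs0 k j (by omega)] at hq
      simp at hq
      exact absurd hq (not_le.2 hε)
    simp only [Finset.coe_product, Finset.coe_range, Set.mem_prod, Set.mem_Iio]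
    omega
  have hsumk : ∀ j, Summable (fun k => δ k * s k j) := by
    intro j
    have := ((hsum 1).prod_symm.prod_factor j)
    simpa using this
  have hbound : ∀ j (C : ℝ), 0 ≤ C → (∀ k, j ≤ k → ‖δ k‖ ≤ C) → ‖∑' k, δ k * s k j‖ ≤ C := by
    intro j C hC h
    apply IsUltrametricDist.norm_tsum_le_of_forall_le
    intro k
    by_cases hk : j ≤ k
    · exact (hterm' k j).trans (h k hk)
    · rw [hs0 k j (by omega)]; simpa using hC
  refine ⟨fun j => ∑' k, δ k * s k j, ?_, ?_, ?_, ?_, ?_⟩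
  · rw [Metric.tendsto_atTop] at h0 ⊢
    intro ε hε
    obtain ⟨N, hN⟩ := h0 (ε / 2) (by positivity)
    refine ⟨N, fun j hj => ?_⟩
    have := hbound j (ε / 2) (by positivity) (fun k hk => by
      have := hN k (by omega)
      rw [dist_zero_right] at this
      exact this.le)
    simp only [dist_zero_right, norm_norm]
    linarith
  · intro x
    have h1 : ∀ j, (∑' k, δ k * s k j) * x ^ j = ∑' k, δ k * s k j * x ^ j := fun j =>
      ((hsumk j).tsum_mul_right (x ^ j)).symm
    simp only [h1]
    have h2 := (Summable.tsum_comm (f := fun k j => δ k * s k j * x ^ j) (hsum x))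
    rw [h2]
    refine tsum_congr fun k => ?_
    rw [tsum_eq_sum (s := Finset.range (k + 1)), ← hsx, Finset.mul_sum]
    · exact Finset.sum_congr rfl fun j _ => mul_assoc _ _ _
    · intro j hj
      rw [hs0 k j (by simpa using hj)]; simp
  · intro j
    exact hbound j _ (norm_nonneg _) (fun k _ => hle k)
  · intro j hj
    exact (hbound j r hr0 (fun k hk => hrlt k (by omega))).trans_lt hr
  · change ‖∑' k, δ k * s k K‖ = _
    rw [(hsumk K).tsum_eq_add_tsum_ite K, hs1, mul_one]
    have : ‖∑' k, (if k = K then 0 else δ k * s k K)‖ ≤ r := by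
      apply IsUltrametricDist.norm_tsum_le_of_forall_le
      intro k
      split_ifs with h
      · simpa using hr0
      · rcases lt_or_gt_of_ne h with h | h
        · rw [hs0 k K h]; simpa using hr0
        · exact (hterm' k K).trans (hrlt k h)
    have hlt2 := this.trans_lt hr
    rw [IsUltrametricDist.norm_add_eq_max_of_norm_ne_norm hlt2.ne', max_eq_left hlt2.le]

lemma vP_le_iff (p : ℕ) [hp : Fact p.Prime] (x y : ℚ_[p]) : vP p x ≤ vP p y ↔ ‖y‖ ≤ ‖x‖ := by
  have hp1 : (1 : ℝ) < p := by exact_mod_cast hp.out.one_lt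
  unfold vP
  by_cases hy : y = 0
  · simp [hy]
  by_cases hx : x = 0
  · simp [hx, hy]
  rw [Padic.addValuation.apply hx, Padic.addValuation.apply hy, WithTop.coe_le_coe,
    Padic.norm_eq_zpow_neg_valuation hx, Padic.norm_eq_zpow_neg_valuation hy,
    zpow_le_zpow_iff_right₀ hp1]
  omega

lemma lrs_fact (p d : ℕ) [hp : Fact p.Prime] (hd : 0 < d) (hpd : d + 1 < p) (β : ℕ → ℤ)
    (R : ℝ) (hR0 : 0 < R) (hR1 : R ≤ 1) (hR : ∀ k < d, ‖((β k : ℤ) : ℚ_[p])‖ ≤ R)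
    (h : ∀ k, d ≤ k → ∃ c : ℕ → ℤ, β k = ∑ i ∈ Finset.range d, c i * (p : ℤ) ^ (k - i) * β i) :
    ∃ δ : ℕ → ℤ_[p], (∀ k, δ k * (k.factorial : ℤ_[p]) = (β k : ℤ_[p])) ∧
      (∀ k < d, ‖δ k‖ = ‖((β k : ℤ) : ℚ_[p])‖) ∧ (∀ k, d ≤ k → ‖δ k‖ < R) ∧
      Tendsto δ atTop (nhds 0) := by
  have hp1 : (1 : ℝ) < p := by exact_mod_cast hp.out.one_lt
  have hp0 : (0 : ℝ) < p := by linarith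
  have hfn : ∀ k : ℕ, ‖((k.factorial : ℕ) : ℚ_[p])‖ = (p : ℝ) ^ (-(padicValNat p k.factorial : ℤ)) := by
    intro k
    rw [Padic.norm_eq_zpow_neg_valuation (by exact_mod_cast k.factorial_ne_zero),
      Padic.valuation_natCast]
  have hv : ∀ k, padicValNat p k.factorial * (d + 1) ≤ k := by
    intro k
    have h1 := sub_one_mul_padicValNat_factorial (p := p) k
    have h2 : (d + 1) * padicValNat p k.factorial ≤ (p - 1) * padicValNat p k.factorial :=
      Nat.mul_le_mul_right _ (by omega)
    rw [mul_comm]; omega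
  have hfd : ∀ k < d, ‖((k.factorial : ℕ) : ℚ_[p])‖ = 1 := by
    intro k hk
    have : padicValNat p k.factorial = 0 := by
      have := hv k
      by_contra h0
      have : 1 * (d + 1) ≤ padicValNat p k.factorial * (d + 1) :=
        Nat.mul_le_mul_right _ (by omega)
      omega
    rw [hfn, this]; simp
  have hβn : ∀ k, d ≤ k → ‖((β k : ℤ) : ℚ_[p])‖ ≤ R * (p : ℝ) ^ (-((k : ℤ) - d + 1)) := by
    intro k hk
    obtain ⟨c, hc⟩ := h k hk
    rw [hc]
    push_cast
    apply IsUltrametricDist.norm_sum_le_of_forall_le_of_nonneg (by positivity)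
    intro i hi
    have hi' := Finset.mem_range.1 hi
    rw [norm_mul, norm_mul, Padic.norm_p_pow]
    have h1 := Padic.norm_int_le_one (p := p) (c i)
    have h2 := hR i hi'
    have h3 : (p : ℝ) ^ (-((k - i : ℕ) : ℤ)) ≤ (p : ℝ) ^ (-((k : ℤ) - d + 1)) :=
      zpow_le_zpow_right₀ hp1.le (by omega)
    calc _ ≤ 1 * (p : ℝ) ^ (-((k : ℤ) - d + 1)) * R := by gcongr
      _ = _ := by ring
  have hq : ∀ k, d ≤ k → ‖((β k : ℤ) : ℚ_[p]) / (k.factorial : ℕ)‖ ≤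
      R * (p : ℝ) ^ (-((k : ℤ) - d + 1) + padicValNat p k.factorial) := by
    intro k hk
    rw [norm_div, hfn, zpow_neg, div_inv_eq_mul, zpow_add₀ hp0.ne', ← mul_assoc]
    gcongr
    exact hβn k hk
  have he : ∀ k, d ≤ k → padicValNat p k.factorial + d ≤ k := by
    intro k hk
    have := hv k
    by_contra hcon
    have h2 : k + 1 ≤ padicValNat p k.factorial + d := by omega
    obtain ⟨t, rfl⟩ := Nat.exists_eq_add_of_le hk
    nlinarith
  have hqR : ∀ k, d ≤ k → ‖((β k : ℤ) : ℚ_[p]) / (k.factorial : ℕ)‖ < R := by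
    intro k hk
    refine (hq k hk).trans_lt ?_
    have := he k hk
    have : (p : ℝ) ^ (-((k : ℤ) - d + 1) + padicValNat p k.factorial) < 1 :=
      zpow_lt_one_of_neg₀ hp1 (by omega)
    nlinarith
  have hqd : ∀ k < d, ‖((β k : ℤ) : ℚ_[p]) / (k.factorial : ℕ)‖ = ‖((β k : ℤ) : ℚ_[p])‖ := by
    intro k hk
    rw [norm_div, hfd k hk, div_one]
  have hq1 : ∀ k, ‖((β k : ℤ) : ℚ_[p]) / (k.factorial : ℕ)‖ ≤ 1 := by
    intro k
    rcases lt_or_ge k d with hk | hk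
    · rw [hqd k hk]; exact Padic.norm_int_le_one _
    · exact (hqR k hk).le.trans hR1
  refine ⟨fun k => (⟨_, hq1 k⟩ : ℤ_[p]), ?_, ?_, ?_, ?_⟩
  · intro k
    apply Subtype.ext
    have : ((k.factorial : ℕ) : ℚ_[p]) ≠ 0 := by exact_mod_cast k.factorial_ne_zero
    push_cast
    exact div_mul_cancel₀ _ this
  · exact hqd
  · exact hqR
  · apply tendsto_zero_iff_norm_tendsto_zero.2
    have hlim : Tendsto (fun k : ℕ => R * (p : ℝ) ^ d * ((p : ℝ)⁻¹) ^ (k / 2)) atTop (nhds 0) := by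
      have h1 : Tendsto (fun k : ℕ => ((p : ℝ)⁻¹) ^ (k / 2)) atTop (nhds 0) :=
        (tendsto_pow_atTop_nhds_zero_of_lt_one (by positivity) (inv_lt_one_of_one_lt₀ hp1)).comp
          (Nat.tendsto_div_const_atTop (by norm_num))
      simpa using h1.const_mul (R * (p : ℝ) ^ d)
    refine squeeze_zero' (Eventually.of_forall fun _ => norm_nonneg _) ?_ hlim
    filter_upwards [eventually_ge_atTop d] with k hk
    refine (hq k hk).trans ?_
    rw [mul_assoc]
    gcongr
    have : (p : ℝ) ^ d * ((p : ℝ)⁻¹) ^ (k / 2) = (p : ℝ) ^ ((d : ℤ) - (k / 2 : ℕ)) := by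
      rw [zpow_sub₀ hp0.ne', zpow_natCast, zpow_natCast, inv_pow, div_eq_mul_inv]
    rw [this]
    apply zpow_le_zpow_right₀ hp1.le
    have h1 := hv k
    have h2 : padicValNat p k.factorial * 2 ≤ padicValNat p k.factorial * (d + 1) :=
      Nat.mul_le_mul_left _ (by omega)
    omega

/-- Let `u` satisfy an order-`d` integer linear recurrence, `p > d+1` a prime
not dividing `a_0`, `A` the companion matrix and `M > 0` with `A^M ≡ I (mod p)`.  Fix `ℓ < M`
with `n ↦ u (M*n+ℓ)` not identically zero and let `β_k` be the `k`-th forward difference at `0`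
of this subsequence.  Then the Mahler series `∑_k β_k binom(x,k)` equals a power series
`∑_j b_j x^j` with `b_j ∈ ℤ_p`, `|b_j|_p → 0`; moreover `min_j v_p(b_j) = min_{k<d} v_p(β_k)`,
and the largest index `j` with `v_p(b_j)` minimal equals the largest `k < d` with `v_p(β_k)`
minimal among `v_p(β_0), …, v_p(β_{d-1})`; in particular this index is at most `d − 1`. -/
theorem lrs_power_series_minimal_index (p d : ℕ) [hp : Fact p.Prime] (hd : 0 < d)
    (hpd : d + 1 < p) (a : Fin d → ℤ) (u : ℕ → ℤ)
    (hrec : ∀ n : ℕ, u (n + d) = ∑ i : Fin d, a i * u (n + i))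
    (ha0 : ¬ ((p : ℤ) ∣ a ⟨0, hd⟩))
    (M : ℕ) (hM : 0 < M)
    (hAM : ∀ i j, (p : ℤ) ∣ ((companionMatrix a) ^ M - 1) i j)
    (ℓ : ℕ) (hℓ : ℓ < M) (hne : ∃ n : ℕ, u (M * n + ℓ) ≠ 0)
    (β : ℕ → ℤ)
    (hβ : ∀ k : ℕ, β k = ∑ j ∈ Finset.range (k + 1),
      (-1 : ℤ) ^ (k - j) * (k.choose j : ℤ) * u (M * j + ℓ)) :
    ∃ b : ℕ → ℤ_[p],
      Tendsto (fun j => ‖b j‖) atTop (nhds 0) ∧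
      (∀ x : ℤ_[p], ∑' j : ℕ, b j * x ^ j = ∑' k : ℕ, ((β k : ℤ) : ℤ_[p]) * Ring.choose x k) ∧
      ∃ j₀ k₀ : ℕ,
        (∀ j : ℕ, vP p (b j₀ : ℚ_[p]) ≤ vP p (b j : ℚ_[p])) ∧
        (∀ j : ℕ, j₀ < j → vP p (b j₀ : ℚ_[p]) < vP p (b j : ℚ_[p])) ∧
        k₀ < d ∧
        (vP p ((β k₀ : ℤ) : ℚ_[p]) =
          (Finset.range d).inf (fun k => vP p ((β k : ℤ) : ℚ_[p]))) ∧
        (∀ k : ℕ, k < d → vP p ((β k : ℤ) : ℚ_[p]) =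
            (Finset.range d).inf (fun k => vP p ((β k : ℤ) : ℚ_[p])) → k ≤ k₀) ∧
        (vP p (b j₀ : ℚ_[p]) =
          (Finset.range d).inf (fun k => vP p ((β k : ℤ) : ℚ_[p]))) ∧
        j₀ = k₀ ∧ j₀ ≤ d - 1 := by
  obtain ⟨hu, hc⟩ := lrs_alg p d hd a u hrec M hAM ℓ β hβ
  obtain ⟨K, hKmem, hKmax⟩ := Finset.exists_max_image (Finset.range d)
    (fun k => toLex (‖((β k : ℤ) : ℚ_[p])‖, k)) ⟨0, Finset.mem_range.2 hd⟩
  have hKd : K < d := Finset.mem_range.1 hKmem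
  have hlex : ∀ k < d, ‖((β k : ℤ) : ℚ_[p])‖ < ‖((β K : ℤ) : ℚ_[p])‖ ∨
      (‖((β k : ℤ) : ℚ_[p])‖ = ‖((β K : ℤ) : ℚ_[p])‖ ∧ k ≤ K) := by
    intro k hk
    have := hKmax k (Finset.mem_range.2 hk)
    rwa [Prod.Lex.toLex_le_toLex] at this
  have hle : ∀ k < d, ‖((β k : ℤ) : ℚ_[p])‖ ≤ ‖((β K : ℤ) : ℚ_[p])‖ := fun k hk =>
    (hlex k hk).elim le_of_lt (fun h => h.1.le)
  have hK0 : 0 < ‖((β K : ℤ) : ℚ_[p])‖ := by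
    by_contra hcon
    have hz : ∀ k < d, β k = 0 := by
      intro k hk
      have := (hle k hk).trans (not_lt.1 hcon)
      simpa using this
    have hz' : ∀ k, β k = 0 := by
      intro k
      rcases lt_or_ge k d with hk | hk
      · exact hz k hk
      · obtain ⟨c, hc⟩ := hc k hk
        rw [hc]
        exact Finset.sum_eq_zero fun i hi => by rw [hz i (Finset.mem_range.1 hi), mul_zero]
    obtain ⟨n, hn⟩ := hne
    apply hn
    rw [hu]
    exact Finset.sum_eq_zero fun i _ => by rw [hz' i, mul_zero]
  obtain ⟨δ, hδ, hδd, hδR, hδ0⟩ := lrs_fact p d hd hpd β _ hK0 (Padic.norm_int_le_one _) hle hc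
  have hδK := hδd K hKd
  obtain ⟨b, hb0, hbx, hb1, hb2, hb3⟩ := lrs_series p δ K hδ0
    (by rw [← norm_pos_iff, hδK]; exact hK0)
    (fun k => by
      rw [hδK]
      rcases lt_or_ge k d with hk | hk
      · rw [hδd k hk]; exact hle k hk
      · exact (hδR k hk).le)
    (fun k hKk => by
      rw [hδK]
      rcases lt_or_ge k d with hk | hk
      · rw [hδd k hk]
        rcases hlex k hk with h | h
        · exact h
        · omega
      · exact hδR k hk)
  have hinf : vP p ((β K : ℤ) : ℚ_[p]) =
      (Finset.range d).inf (fun k => vP p ((β k : ℤ) : ℚ_[p])) := by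
    apply le_antisymm
    · apply Finset.le_inf
      intro k hk
      exact (vP_le_iff p _ _).2 (hle k (Finset.mem_range.1 hk))
    · exact Finset.inf_le hKmem
  refine ⟨b, hb0, ?_, K, K, ?_, ?_, hKd, hinf, ?_, ?_, rfl, by omega⟩
  · intro x
    rw [hbx]
    refine tsum_congr fun k => ?_
    rw [← mul_assoc, hδ]
  · intro j
    rw [vP_le_iff, ← PadicInt.norm_def, ← PadicInt.norm_def, hb3]
    exact hb1 j
  · intro j hj
    rw [← not_le, vP_le_iff, not_le, ← PadicInt.norm_def, ← PadicInt.norm_def, hb3]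
    exact hb2 j hj
  · intro k hk hk2
    rw [← hinf] at hk2
    have := (vP_le_iff p _ _).1 hk2.le
    rcases hlex k hk with h | h
    · exact absurd this (not_le.2 h)
    · exact h.2
  · rw [← hinf]
    apply le_antisymm
    · rw [vP_le_iff, ← PadicInt.norm_def, hb3, hδK]
    · rw [vP_le_iff, ← PadicInt.norm_def, hb3, hδK]
end

section
/- Let u : ℕ → ℤ satisfy an order-d integer linear recurrence u_{n+d} = a_{d-1} u_{n+d-1} + … + a_0 u_n, let p be a prime with p > d+1 and p ∤ a_0, let A be the companion matrix of the recurrence, and let M be a positive integer with A^M ≡ I (mod p). Then there exist a subset L ⊆ {0, …, M−1} and a finite set S ⊆ ℕ with |S| ≤ (d−1)·M such that {n ∈ ℕ : u_n = 0} = (⋃_{ℓ ∈ L} {Mn + ℓ : n ∈ ℕ}) ∪ S. -/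
open Finset

lemma nat_unit_aux (p : ℕ) [hp : Fact p.Prime] (k : ℕ) (hk : ¬ p ∣ k) :
    IsUnit (k : ℤ_[p]) := by
  rw [PadicInt.isUnit_iff]
  refine le_antisymm (PadicInt.norm_le_one _) (not_lt.1 fun h => hk ?_)
  have := (PadicInt.norm_int_lt_one_iff_dvd (p := p) (k : ℤ)).1 (by exact_mod_cast h)
  exact_mod_cast this

lemma fact_dvd_aux (p d : ℕ) [hp : Fact p.Prime] (hpd : d + 1 < p) (k : ℕ) (hk : d ≤ k)
    (hk0 : 0 < k) : ((p : ℤ_[p]) ^ d * (k.factorial : ℤ_[p])) ∣ (p : ℤ_[p]) ^ k := by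
  have hp1 : p ≠ 1 := hp.out.one_lt.ne'
  obtain ⟨v, q, hq, hkq⟩ := Nat.exists_eq_pow_mul_and_not_dvd (Nat.factorial_ne_zero k) p hp1
  have hval : padicValNat p k.factorial = v := by
    rw [hkq, padicValNat.mul (pow_ne_zero _ hp.out.ne_zero) (by rintro rfl; simp at hq),
      padicValNat.prime_pow, padicValNat.eq_zero_of_not_dvd hq, add_zero]
  have hlt := sub_one_mul_padicValNat_factorial_lt_of_ne_zero p (n := k) hk0.ne'
  rw [hval] at hlt
  have hle : d + v ≤ k := by
    rcases Nat.eq_zero_or_pos v with rfl | hv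
    · omega
    · have h1 : (d + 1) * v ≤ (p - 1) * v := Nat.mul_le_mul_right _ (by omega)
      nlinarith
  rw [hkq]
  push_cast
  rw [← mul_assoc, ← pow_add, (nat_unit_aux p q hq).mul_right_dvd]
  exact pow_dvd_pow _ hle

lemma exists_fact_aux (p : ℕ) [hp : Fact p.Prime] (k : ℕ) (hk : k < p) (x : ℤ_[p]) :
    ∃ e : ℤ_[p], e * (k.factorial : ℤ_[p]) = x := by
  have : IsUnit (k.factorial : ℤ_[p]) :=
    nat_unit_aux p _ fun h => by
      have := (Nat.Prime.dvd_factorial hp.out).1 h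
      omega
  obtain ⟨v, hv⟩ := this
  exact ⟨x * ↑v⁻¹, by rw [← hv]; simp⟩

lemma key_step (p d : ℕ) [hp : Fact p.Prime] (hd : 0 < d) (hpd : d + 1 < p) (c : ℕ → ℤ)
    (T : Finset ℕ) (hT : T.card = d)
    (hz : ∀ n ∈ T, ∑ k ∈ range (n + 1), (n.choose k : ℤ) * ((p : ℤ) ^ k * c k) = 0)
    (m : ℕ) (hm : ∀ k, (p : ℤ) ^ m ∣ c k) : ∀ k < d, (p : ℤ) ^ (m + 1) ∣ c k := by
  classical
  obtain ⟨N, hN⟩ : ∃ N, ∀ n ∈ T, n < N := ⟨T.sup id + 1, fun n hn =>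
    Nat.lt_succ_of_le (Finset.le_sup (f := id) hn)⟩
  have he : ∀ k, ∃ e : ℤ_[p], k < d →
      e * (k.factorial : ℤ_[p]) = (p : ℤ_[p]) ^ k * (c k : ℤ_[p]) := by
    intro k
    by_cases hk : k < d
    · obtain ⟨e, he⟩ := exists_fact_aux p k (by omega) ((p : ℤ_[p]) ^ k * (c k : ℤ_[p]))
      exact ⟨e, fun _ => he⟩
    · exact ⟨0, fun h => absurd h hk⟩
  choose e he using he
  have hh : ∀ i, ∃ h : ℤ_[p], (p : ℤ_[p]) ^ (d + m) * (h * ((d + i).factorial : ℤ_[p])) =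
      (p : ℤ_[p]) ^ (d + i) * (c (d + i) : ℤ_[p]) := by
    intro i
    obtain ⟨q, hq⟩ := fact_dvd_aux p d hpd (d + i) (by omega) (by omega)
    obtain ⟨r, hr⟩ := hm (d + i)
    refine ⟨q * r, ?_⟩
    rw [hq, hr]
    push_cast
    ring
  choose h hh using hh
  set P : Polynomial ℤ_[p] := ∏ n ∈ T, (Polynomial.X - Polynomial.C (n : ℤ_[p])) with hP
  have hPm : P.Monic := Polynomial.monic_prod_X_sub_C _ _
  have hPd : P.degree = d := by
    rw [hP, Polynomial.degree_prod]
    simp only [Polynomial.degree_X_sub_C]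
    simp [hT]
  set R : Polynomial ℤ_[p] := ∑ k ∈ range d, Polynomial.C (e k) * descPochhammer ℤ_[p] k with hR
  set H : Polynomial ℤ_[p] :=
    ∑ i ∈ range N, Polynomial.C (h i) * descPochhammer ℤ_[p] (d + i) with hH
  have hRd : R.degree < P.degree := by
    rw [hPd]
    refine (Polynomial.degree_sum_le _ _).trans_lt ?_
    refine (Finset.sup_lt_iff (WithBot.bot_lt_coe d)).2 ?_
    intro k hk
    refine Polynomial.degree_le_natDegree.trans_lt ?_
    refine (WithBot.coe_le_coe.2 (Polynomial.natDegree_C_mul_le _ _)).trans_lt ?_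
    rw [descPochhammer_natDegree]
    exact_mod_cast Finset.mem_range.1 hk
  have hdf : ∀ n k : ℕ, (descPochhammer ℤ_[p] k).eval (n : ℤ_[p]) =
      (k.factorial : ℤ_[p]) * (n.choose k : ℤ_[p]) := by
    intro n k
    rw [descPochhammer_eval_eq_descFactorial, Nat.descFactorial_eq_factorial_mul_choose]
    push_cast; rfl
  have hRe : ∀ n : ℕ, R.eval (n : ℤ_[p]) =
      ∑ k ∈ range d, (n.choose k : ℤ_[p]) * ((p : ℤ_[p]) ^ k * (c k : ℤ_[p])) := by
    intro n
    rw [hR, Polynomial.eval_finsetSum]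
    refine Finset.sum_congr rfl fun k hk => ?_
    rw [Polynomial.eval_mul, Polynomial.eval_C, hdf, ← he k (Finset.mem_range.1 hk)]
    ring
  have hHe : ∀ n : ℕ, (p : ℤ_[p]) ^ (d + m) * H.eval (n : ℤ_[p]) =
      ∑ i ∈ range N, (n.choose (d + i) : ℤ_[p]) *
        ((p : ℤ_[p]) ^ (d + i) * (c (d + i) : ℤ_[p])) := by
    intro n
    rw [hH, Polynomial.eval_finsetSum, Finset.mul_sum]
    refine Finset.sum_congr rfl fun k hk => ?_
    rw [Polynomial.eval_mul, Polynomial.eval_C, hdf, ← hh k]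
    ring
  have hroot : ∀ n ∈ T, (R + Polynomial.C ((p : ℤ_[p]) ^ (d + m)) * H).eval (n : ℤ_[p]) = 0 := by
    intro n hn
    rw [Polynomial.eval_add, Polynomial.eval_mul, Polynomial.eval_C, hRe, hHe,
      ← Finset.sum_range_add (fun k => (n.choose k : ℤ_[p]) * ((p : ℤ_[p]) ^ k * (c k : ℤ_[p])))]
    have h1 := congrArg (Int.cast : ℤ → ℤ_[p]) (hz n hn)
    push_cast at h1
    rw [← h1]
    symm
    refine Finset.sum_subset ?_ ?_
    · intro k hk
      have := hN n hn
      simp only [Finset.mem_range] at *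
      omega
    · intro k _ hk
      simp only [Finset.mem_range] at hk
      rw [Nat.choose_eq_zero_of_lt (by omega)]
      simp
  have hdvd : P ∣ R + Polynomial.C ((p : ℤ_[p]) ^ (d + m)) * H := by
    refine Finset.prod_dvd_of_isRelPrime ?_ fun n hn =>
      Polynomial.dvd_iff_isRoot.2 (hroot n hn)
    intro x _ y _ hxy
    refine (Polynomial.irreducible_X_sub_C _).isRelPrime_iff_not_dvd.2 fun hdv => hxy ?_
    have h1 := Polynomial.dvd_iff_isRoot.1 hdv
    simp only [Polynomial.IsRoot.def, Polynomial.eval_sub, Polynomial.eval_X,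
      Polynomial.eval_C] at h1
    exact_mod_cast sub_eq_zero.1 h1
  have hReq : R = - (Polynomial.C ((p : ℤ_[p]) ^ (d + m)) * (H %ₘ P)) := by
    have h1 := (Polynomial.modByMonic_eq_zero_iff_dvd hPm).2 hdvd
    rw [Polynomial.add_modByMonic, (Polynomial.modByMonic_eq_self_iff hPm).2 hRd,
      ← Polynomial.smul_eq_C_mul, Polynomial.smul_modByMonic, Polynomial.smul_eq_C_mul] at h1
    exact eq_neg_of_add_eq_zero_left h1
  have hval : ∀ n : ℕ, (p : ℤ) ^ (d + m) ∣
      ∑ k ∈ range d, (n.choose k : ℤ) * ((p : ℤ) ^ k * c k) := by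
    intro n
    have : (p : ℤ_[p]) ^ (d + m) ∣ R.eval (n : ℤ_[p]) := by
      rw [hReq, Polynomial.eval_neg, Polynomial.eval_mul, Polynomial.eval_C]
      exact (Dvd.intro _ rfl).neg_right
    rw [hRe] at this
    rw [← PadicInt.pow_p_dvd_int_iff]
    push_cast
    exact this
  intro k
  have hk' : ∀ k < d, (p : ℤ) ^ (d + m) ∣ (p : ℤ) ^ k * c k := by
    intro k
    induction k using Nat.strong_induction_on with
    | _ k ih =>
      intro hk
      have h1 := hval k
      rw [← Finset.sum_erase_add _ _ (Finset.mem_range.2 hk)] at h1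
      rw [Nat.choose_self, Nat.cast_one, one_mul] at h1
      refine (dvd_add_right (Finset.dvd_sum fun j hj => ?_)).1 h1
      simp only [Finset.mem_erase, Finset.mem_range] at hj
      rcases lt_or_gt_of_ne hj.1 with hlt | hgt
      · exact (ih j hlt hj.2).mul_left _
      · rw [Nat.choose_eq_zero_of_lt hgt]; simp
  intro hk
  have h1 := hk' k hk
  have h2 : (p : ℤ) ^ k * (p : ℤ) ^ (m + 1) ∣ (p : ℤ) ^ k * c k := by
    rw [← pow_add]
    exact (pow_dvd_pow _ (by omega)).trans h1
  exact (mul_dvd_mul_iff_left (pow_ne_zero _ (by exact_mod_cast hp.out.ne_zero))).1 h2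

lemma key_all (p d : ℕ) [hp : Fact p.Prime] (hd : 0 < d) (hpd : d + 1 < p) (c : ℕ → ℤ)
    (T : Finset ℕ) (hT : T.card = d)
    (hz : ∀ n ∈ T, ∑ k ∈ range (n + 1), (n.choose k : ℤ) * ((p : ℤ) ^ k * c k) = 0)
    (hc : ∀ q : ℤ, (∀ k < d, q ∣ c k) → ∀ k, q ∣ c k) : ∀ k, c k = 0 := by
  have h : ∀ m k, (p : ℤ) ^ m ∣ c k := by
    intro m
    induction m with
    | zero => intro k; simp
    | succ m ih => exact hc _ (key_step p d hd hpd c T hT hz m ih)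
  intro k
  by_contra hk
  have hf : FiniteMultiplicity (p : ℤ) (c k) := by
    rw [Int.finiteMultiplicity_iff]
    exact ⟨by simpa using hp.out.one_lt.ne', hk⟩
  obtain ⟨n, hn⟩ := hf
  exact hn (h _ _)

lemma state_step {d : ℕ} (hd : 0 < d) (a : Fin d → ℤ) (u : ℕ → ℤ)
    (hrec : ∀ n : ℕ, u (n + d) = ∑ i : Fin d, a i * u (n + i)) (n : ℕ) :
    (companionMatrix a).mulVec (fun i : Fin d => u (n + (i.rev : ℕ))) =
      fun i : Fin d => u (n + 1 + (i.rev : ℕ)) := by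
  ext i
  simp only [Matrix.mulVec, dotProduct, companionMatrix, Matrix.of_apply]
  by_cases hi : (i : ℕ) = 0
  · simp only [hi, if_true]
    rw [Fin.val_rev, hi, show n + 1 + (d - (0 + 1)) = n + d by omega, hrec]
    exact Equiv.sum_comp Fin.revPerm (fun j : Fin d => a j * u (n + j))
  · simp only [hi, if_false]
    have hi' := i.2
    rw [Finset.sum_eq_single (⟨i - 1, by omega⟩ : Fin d)]
    · simp only [Fin.val_rev]
      rw [if_pos (by omega), one_mul]
      congr 1
      omega
    · intro b _ hb
      rw [if_neg, zero_mul]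
      intro h
      apply hb
      ext
      simp
      omega
    · simp

lemma state_pow {d : ℕ} (hd : 0 < d) (a : Fin d → ℤ) (u : ℕ → ℤ)
    (hrec : ∀ n : ℕ, u (n + d) = ∑ i : Fin d, a i * u (n + i)) (l n : ℕ) :
    (companionMatrix a ^ n).mulVec (fun i : Fin d => u (l + (i.rev : ℕ))) =
      fun i : Fin d => u (l + n + (i.rev : ℕ)) := by
  induction n with
  | zero => simp
  | succ n ih =>
    rw [pow_succ', ← Matrix.mulVec_mulVec, ih, state_step hd a u hrec]
    rfl

lemma prog (p d : ℕ) (hp : p.Prime) (hd : 0 < d)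
    (hpd : d + 1 < p) (a : Fin d → ℤ) (u : ℕ → ℤ)
    (hrec : ∀ n : ℕ, u (n + d) = ∑ i : Fin d, a i * u (n + i))
    (M : ℕ) (hAM : ∀ i j, (p : ℤ) ∣ ((companionMatrix a) ^ M - 1) i j) (l : ℕ)
    (T : Finset ℕ) (hT : T.card = d) (hz : ∀ n ∈ T, u (M * n + l) = 0) :
    ∀ n, u (M * n + l) = 0 := by
  haveI : Fact p.Prime := ⟨hp⟩
  choose B hB using hAM
  let B' : Matrix (Fin d) (Fin d) ℤ := Matrix.of B
  have hA : companionMatrix a ^ M = (p : ℤ) • B' + 1 := by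
    rw [← sub_eq_iff_eq_add]
    ext i j
    simpa [B'] using hB i j
  let s : Fin d → ℤ := fun i => u (l + (i.rev : ℕ))
  let z : Fin d := ⟨d - 1, by omega⟩
  let φ : Matrix (Fin d) (Fin d) ℤ →ₗ[ℤ] ℤ :=
    { toFun := fun X => X.mulVec s z
      map_add' := by intro X Y; rw [Matrix.add_mulVec]; rfl
      map_smul' := by intro r X; rw [Matrix.smul_mulVec]; rfl }
  have hu : ∀ n, u (M * n + l) =
      ∑ k ∈ range (n + 1), (n.choose k : ℤ) * ((p : ℤ) ^ k * φ (B' ^ k)) := by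
    intro n
    have h1 := congrFun (state_pow hd a u hrec l (M * n)) z
    have h2 : u (M * n + l) = φ (companionMatrix a ^ (M * n)) := by
      refine Eq.trans ?_ h1.symm
      simp only [z, Fin.val_rev]
      congr 1
      omega
    rw [h2, pow_mul, hA, (Commute.one_right _).add_pow, map_sum]
    refine Finset.sum_congr rfl fun k _ => ?_
    rw [one_pow, mul_one, smul_pow, ← nsmul_eq_mul', map_nsmul, map_smul]
    simp
  have hc : ∀ q : ℤ, (∀ k < d, q ∣ φ (B' ^ k)) → ∀ k, q ∣ φ (B' ^ k) := by
    intro q hq k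
    rw [Matrix.pow_eq_aeval_mod_charpoly, Polynomial.aeval_eq_sum_range, map_sum]
    refine Finset.dvd_sum fun i hi => ?_
    rw [map_smul]
    by_cases hid : i < d
    · exact (hq i hid).mul_left _
    · rw [Polynomial.coeff_eq_zero_of_degree_lt]
      · simp
      · refine (Polynomial.degree_modByMonic_lt _ B'.charpoly_monic).trans_le ?_
        rw [Matrix.charpoly_degree_eq_dim, Fintype.card_fin]
        exact_mod_cast not_lt.1 hid
  have h0 := key_all p d hd hpd (fun k => φ (B' ^ k)) T hT
    (fun n hn => by rw [← hu]; exact hz n hn) hc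
  intro n
  rw [hu]
  exact Finset.sum_eq_zero fun k _ => by rw [show φ (B' ^ k) = 0 from h0 k]; simp

/-- Let `u` satisfy an order-`d` integer linear recurrence, `p > d+1` a prime
not dividing `a_0`, `A` the companion matrix and `M > 0` with `A^M ≡ I (mod p)`.  Then the zero
set of `u` is the union of full arithmetic progressions `{M*n + ℓ : n ∈ ℕ}` for `ℓ` in some
subset `L` of `{0, …, M−1}`, together with a finite set of at most `(d−1)·M` extra elements. -/
theorem lrs_zero_set_decomposition (p d : ℕ) (hp : p.Prime) (hd : 0 < d)
    (hpd : d + 1 < p) (a : Fin d → ℤ) (u : ℕ → ℤ)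
    (hrec : ∀ n : ℕ, u (n + d) = ∑ i : Fin d, a i * u (n + i))
    (ha0 : ¬ ((p : ℤ) ∣ a ⟨0, hd⟩))
    (M : ℕ) (hM : 0 < M)
    (hAM : ∀ i j, (p : ℤ) ∣ ((companionMatrix a) ^ M - 1) i j) :
    ∃ L : Finset ℕ, L ⊆ Finset.range M ∧
    ∃ S : Finset ℕ, S.card ≤ (d - 1) * M ∧
      {n : ℕ | u n = 0} =
        (⋃ ℓ ∈ L, {m : ℕ | ∃ n : ℕ, m = M * n + ℓ}) ∪ (S : Set ℕ) := by
  classical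
  have key := prog p d hp hd hpd a u hrec M hAM
  let Z : ℕ → Set ℕ := fun l => {n | u (M * n + l) = 0}
  let L := (Finset.range M).filter fun l => ∀ n, u (M * n + l) = 0
  have hfin : ∀ l, ∃ F : Finset ℕ, F.card ≤ d - 1 ∧
      ((¬ ∀ n, u (M * n + l) = 0) → ∀ n, n ∈ F ↔ u (M * n + l) = 0) := by
    intro l
    by_cases hl : ∀ n, u (M * n + l) = 0
    · exact ⟨∅, by simp, fun h => absurd hl h⟩
    · have hsub : ∀ T : Finset ℕ, (↑T : Set ℕ) ⊆ Z l → T.card ≤ d - 1 := by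
        intro T hT
        by_contra hcard
        obtain ⟨T', hT', hc⟩ := Finset.exists_subset_card_eq (show d ≤ T.card by omega)
        exact hl (key l T' hc fun n hn => hT (hT' hn))
      have hZ : (Z l).Finite := by
        by_contra hinf
        obtain ⟨T, hT, hc⟩ := Set.Infinite.exists_subset_card_eq hinf d
        have := hsub T hT
        omega
      refine ⟨hZ.toFinset, hsub _ (by simp), fun _ n => ?_⟩
      simp [Z]
  choose F hF1 hF2 using hfin
  refine ⟨L, Finset.filter_subset _ _, ((Finset.range M) \ L).biUnion
    fun l => (F l).image fun n => M * n + l, ?_, ?_⟩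
  · refine (Finset.card_biUnion_le_card_mul _ _ (d - 1) fun l _ =>
      Finset.card_image_le.trans (hF1 l)).trans ?_
    rw [mul_comm]
    refine Nat.mul_le_mul_left _ ?_
    exact (Finset.card_le_card Finset.sdiff_subset).trans (by simp)
  · ext n
    simp only [Set.mem_setOf_eq, Set.mem_union, Set.mem_iUnion, Finset.mem_coe,
      Finset.mem_biUnion, Finset.mem_image, Finset.mem_sdiff, exists_prop]
    constructor
    · intro hn
      have hlt := Nat.mod_lt n hM
      have hdm := Nat.div_add_mod n M
      by_cases hl : n % M ∈ L
      · exact Or.inl ⟨n % M, hl, n / M, hdm.symm⟩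
      · refine Or.inr ⟨n % M, ⟨Finset.mem_range.2 hlt, hl⟩, n / M, ?_, hdm⟩
        refine (hF2 _ ?_ _).2 (by rw [hdm]; exact hn)
        intro h
        exact hl (Finset.mem_filter.2 ⟨Finset.mem_range.2 hlt, h⟩)
    · rintro (⟨l, hl, k, rfl⟩ | ⟨l, ⟨hl1, hl2⟩, k, hk, rfl⟩)
      · exact (Finset.mem_filter.1 hl).2 k
      · refine (hF2 l ?_ k).1 hk
        intro h
        exact hl2 (Finset.mem_filter.2 ⟨hl1, h⟩)
end
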